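/- A word u ∈ L(Ω) is left-special if and only if u is a (finite, possibly empty) prefix of the fixed point ω. -/

import Mathlib

/-- The substitution σ on the alphabet A = {1, …, d}:
σ(1) = 12, σ(k) = k+1 for 2 ≤ k ≤ d−1, σ(d) = 1. Letters are literal natural numbers. -/
def sig (d : ℕ) (a : ℕ) : List ℕ :=
  if a = 1 then [1, 2] else if a = d then [1] else [a + 1]

/-- Extension of a substitution to finite words by concatenation. -/
def applySub (f : ℕ → List ℕ) : List ℕ → List ℕ
  | [] => []
  | a :: w => f a ++ applySub f w

/-- σⁿ applied to a word. -/
def sigIter (d n : ℕ) (w : List ℕ) : List ℕ := (applySub (sig d))^[n] w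

/-- The language L(Ω): the set of finite factors of the fixed point ω, i.e. of the
words σⁿ(1). -/
def Lang (d : ℕ) (u : List ℕ) : Prop := ∃ n : ℕ, u <:+: sigIter d n [1]

/-- `w` is a (finite) prefix of the infinite word `V`. -/
def PrefixOfInf (w : List ℕ) (V : ℕ → ℕ) : Prop :=
  ∀ (i : ℕ) (h : i < w.length), w.get ⟨i, h⟩ = V i

/-- `ω` is the fixed point of σ: the unique infinite word admitting every σⁿ(1) as a
prefix. -/
def IsSigmaFixedPoint (d : ℕ) (ω : ℕ → ℕ) : Prop :=
  ∀ n : ℕ, PrefixOfInf (sigIter d n [1]) ω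

/-- `u` is left-special: there are distinct letters a, b ∈ A with au, bu ∈ L(Ω). -/
def LeftSpecial (d : ℕ) (u : List ℕ) : Prop :=
  ∃ a b : ℕ, a ≠ b ∧ 1 ≤ a ∧ a ≤ d ∧ 1 ≤ b ∧ b ≤ d ∧
    Lang d (a :: u) ∧ Lang d (b :: u)

/-- `u` is right-special: there are distinct letters a, b ∈ A with ua, ub ∈ L(Ω). -/
def RightSpecial (d : ℕ) (u : List ℕ) : Prop :=
  ∃ a b : ℕ, a ≠ b ∧ 1 ≤ a ∧ a ≤ d ∧ 1 ≤ b ∧ b ≤ d ∧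
    Lang d (u ++ [a]) ∧ Lang d (u ++ [b])

/-- `u` is bispecial: both left- and right-special. -/
def Bispecial (d : ℕ) (u : List ℕ) : Prop := LeftSpecial d u ∧ RightSpecial d u

/-- The shift S on infinite words. -/
def shiftMap (V : ℕ → ℕ) : ℕ → ℕ := fun i => V (i + 1)

/-- Ω⁺ : the closure (for the product topology, letters discrete) of the shift
orbit of ω. -/
def OmegaPlus (ω : ℕ → ℕ) : Set (ℕ → ℕ) :=
  closure {V : ℕ → ℕ | ∃ n : ℕ, V = shiftMap^[n] ω}

/-- The cylinder C_u = {V ∈ Ω⁺ : u is a prefix of V}. -/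
def Cyl (ω : ℕ → ℕ) (u : List ℕ) : Set (ℕ → ℕ) :=
  {V | V ∈ OmegaPlus ω ∧ PrefixOfInf u V}

/-- Prepending a letter to an infinite word. -/
def consInf (a : ℕ) (V : ℕ → ℕ) : ℕ → ℕ :=
  fun i => match i with
  | 0 => a
  | j + 1 => V j

/-- Extension of σ to infinite words: σ(V) = σ(V₀)σ(V₁)σ(V₂)⋯ (each σ(a) is a
nonempty word, so the n-th letter of σ(V) is the n-th letter of σ(V₀…Vₙ)). -/
def sigInf (d : ℕ) (V : ℕ → ℕ) : ℕ → ℕ :=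
  fun n => (applySub (sig d) ((List.range (n + 1)).map V)).getD n 0

/-- Concatenation of a finite list of words. -/
def concatAll : List (List ℕ) → List ℕ
  | [] => []
  | w :: ws => w ++ concatAll ws

lemma applySub_append (f : ℕ → List ℕ) (u v : List ℕ) :
    applySub f (u ++ v) = applySub f u ++ applySub f v := by
  induction u with
  | nil => rfl
  | cons a u ih => simp [applySub, ih]

lemma applySub_prefix (f : ℕ → List ℕ) {u v : List ℕ} (h : u <+: v) :
    applySub f u <+: applySub f v := by
  obtain ⟨t, rfl⟩ := h
  exact ⟨applySub f t, (applySub_append f u t).symm⟩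

lemma sigIter_zero (d : ℕ) (w : List ℕ) : sigIter d 0 w = w := rfl

lemma sigIter_succ (d n : ℕ) (w : List ℕ) :
    sigIter d (n + 1) w = applySub (sig d) (sigIter d n w) :=
  Function.iterate_succ_apply' _ _ _

lemma sigIter_append (d n : ℕ) (u v : List ℕ) :
    sigIter d n (u ++ v) = sigIter d n u ++ sigIter d n v := by
  induction n with
  | zero => rfl
  | succ n ih => simp only [sigIter_succ, ih, applySub_append]

lemma length_le_length_applySub_sig (d : ℕ) (w : List ℕ) :
    w.length ≤ (applySub (sig d) w).length := by
  induction w with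
  | nil => simp
  | cons a w ih =>
    simp only [applySub, sig, List.length_append, List.length_cons]
    split_ifs <;> simp <;> omega

lemma length_le_length_sigIter (d n : ℕ) (w : List ℕ) :
    w.length ≤ (sigIter d n w).length := by
  induction n with
  | zero => rfl
  | succ n ih =>
    rw [sigIter_succ]
    exact ih.trans (length_le_length_applySub_sig d _)

lemma sigIter_succ_one (d n : ℕ) :
    sigIter d (n + 1) [1] = sigIter d n [1] ++ sigIter d n [2] := by
  rw [← sigIter_append]
  rfl

lemma sigIter_one_prefix (d : ℕ) {m n : ℕ} (h : m ≤ n) :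
    sigIter d m [1] <+: sigIter d n [1] := by
  induction n, h using Nat.le_induction with
  | base => exact List.prefix_rfl
  | succ n _ ih =>
    rw [sigIter_succ_one]
    exact ih.trans (List.prefix_append _ _)

lemma lt_length_sigIter_one (d n : ℕ) : n < (sigIter d n [1]).length := by
  induction n with
  | zero => simp [sigIter_zero]
  | succ n ih =>
    have h := length_le_length_sigIter d n [2]
    rw [sigIter_succ_one, List.length_append]
    simp only [List.length_cons, List.length_nil] at h
    omega

lemma prefixOfInf_iff {d : ℕ} {ω : ℕ → ℕ} (hω : IsSigmaFixedPoint d ω) (u : List ℕ) :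
    PrefixOfInf u ω ↔ ∃ n, u <+: sigIter d n [1] := by
  constructor
  · intro h
    have hl := lt_length_sigIter_one d u.length
    refine ⟨u.length, List.prefix_iff_getElem.2 ⟨hl.le, fun i hi => ?_⟩⟩
    exact (h i hi).trans (hω u.length i (hi.trans hl)).symm
  · rintro ⟨n, h⟩ i hi
    exact (List.IsPrefix.getElem h hi).trans (hω n i (hi.trans_le h.length_le))

/-- The relation satisfied by two consecutive letters of the fixed point. -/
def LetterStep (d x y : ℕ) : Prop := y = 1 ∨ (y = x + 1 ∧ y ≤ d ∧ 1 ≤ x)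

lemma isChain_applySub_sig {d : ℕ} (hd : 3 ≤ d) {w : List ℕ}
    (h : w.IsChain (LetterStep d)) : (applySub (sig d) w).IsChain (LetterStep d) := by
  induction w with
  | nil => simp [applySub]
  | cons a w ih =>
    rw [applySub, List.isChain_append]
    refine ⟨?_, ih h.of_cons, ?_⟩
    · unfold sig
      split_ifs <;> simp [LetterStep]
      omega
    · intro x hx y hy
      cases w with
      | nil => simp [applySub] at hy
      | cons b w =>
        have hab : LetterStep d a b := (List.isChain_cons_cons.1 h).1
        unfold LetterStep at hab ⊢
        simp only [applySub, sig] at hx hy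
        split_ifs at hx hy <;> simp at hx hy <;> omega

lemma isChain_sigIter_one {d : ℕ} (hd : 3 ≤ d) (n : ℕ) :
    (sigIter d n [1]).IsChain (LetterStep d) := by
  induction n with
  | zero => simp [sigIter_zero]
  | succ n ih =>
    rw [sigIter_succ]
    exact isChain_applySub_sig hd ih

lemma pos_of_mem_applySub_sig {d : ℕ} {w : List ℕ} {a : ℕ}
    (h : a ∈ applySub (sig d) w) : 1 ≤ a := by
  induction w with
  | nil => simp [applySub] at h
  | cons b w ih =>
    rw [applySub, List.mem_append] at h
    rcases h with h | h
    · unfold sig at h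
      split_ifs at h <;> simp at h <;> omega
    · exact ih h

lemma pos_of_mem_sigIter_one {d n a : ℕ} (h : a ∈ sigIter d n [1]) : 1 ≤ a := by
  cases n with
  | zero => simp [sigIter_zero] at h; omega
  | succ n =>
    rw [sigIter_succ] at h
    exact pos_of_mem_applySub_sig h

/-- Desubstitution of a word at an occurrence of the letter `1`. -/
lemma exists_eq_append_of_applySub_sig {d a : ℕ} {s r z : List ℕ}
    (h : applySub (sig d) z = s ++ a :: 1 :: r) :
    ∃ p b x, z = p ++ b :: x ∧ (sig d b).getLast? = some a ∧
      applySub (sig d) x = 1 :: r := by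
  induction z generalizing s with
  | nil => simp [applySub] at h
  | cons c z ih =>
    have step : ∀ s', applySub (sig d) z = s' ++ a :: 1 :: r →
        ∃ p b x, c :: z = p ++ b :: x ∧ (sig d b).getLast? = some a ∧
          applySub (sig d) x = 1 :: r := by
      intro s' hs
      obtain ⟨p, b, x, rfl, h₁, h₂⟩ := ih hs
      exact ⟨c :: p, b, x, rfl, h₁, h₂⟩
    rw [applySub] at h
    have hc : sig d c = [1, 2] ∨ ∃ k, sig d c = [k] := by
      unfold sig
      split_ifs <;> simp
    rcases hc with hc | ⟨k, hc⟩
    · rw [hc] at h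
      rcases s with _ | ⟨x, _ | ⟨y, s⟩⟩
      · simp at h
      · simp only [List.cons_append, List.nil_append, List.cons.injEq] at h
        exact ⟨[], c, z, rfl, by simp [hc, h.2.1], h.2.2⟩
      · simp only [List.cons_append, List.nil_append, List.cons.injEq] at h
        exact step s h.2.2
    · rw [hc] at h
      rcases s with _ | ⟨x, s⟩
      · simp only [List.cons_append, List.nil_append, List.cons.injEq] at h
        exact ⟨[], c, z, rfl, by simp [hc, h.1], h.2⟩
      · simp only [List.cons_append, List.nil_append, List.cons.injEq] at h
        exact step s h.2

lemma head?_applySub_sig_ne_two (d : ℕ) (w : List ℕ) :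
    (applySub (sig d) w).head? ≠ some 2 := by
  cases w with
  | nil => simp [applySub]
  | cons a w =>
    simp only [applySub, sig]
    split_ifs <;> simp
    assumption

lemma eq_singleton_of_prefix {d : ℕ} {t w y : List ℕ} (h₁ : t <+: 2 :: w)
    (h₂ : t <+: applySub (sig d) y) : t = [] := by
  rcases t with _ | ⟨k, t⟩
  · rfl
  · obtain rfl : k = 2 := (List.cons_prefix_cons.1 h₁).1
    obtain ⟨r, hr⟩ := h₂
    exact absurd (by simp [← hr]) (head?_applySub_sig_ne_two d y)

/-- A common prefix of `σ(x)` and `σ(y)` is a prefix of `σ(v)`, or equal to `σ(v)1`, for some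
common prefix `v` of `x` and `y`; in the latter case `v` is followed by `d` in `x` or `y`. -/
lemma exists_common_prefix {d : ℕ} {u x y : List ℕ} (hx : ∀ c ∈ x, 1 ≤ c)
    (hy : ∀ c ∈ y, 1 ≤ c) (hux : u <+: applySub (sig d) x)
    (huy : u <+: applySub (sig d) y) :
    ∃ v, v <+: x ∧ v <+: y ∧ (u <+: applySub (sig d) v ∨
      (u = applySub (sig d) v ++ [1] ∧ (v ++ [d] <+: x ∨ v ++ [d] <+: y))) := by
  induction x generalizing u y with
  | nil => exact ⟨[], List.nil_prefix, List.nil_prefix, Or.inl hux⟩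
  | cons c x ih =>
    rcases y with _ | ⟨c', y⟩
    · exact ⟨[], List.nil_prefix, List.nil_prefix, Or.inl huy⟩
    by_cases hcc : c = c'
    · subst hcc
      rw [applySub] at hux huy
      rcases List.prefix_or_prefix_of_prefix hux (List.prefix_append (sig d c) _) with h | h
      · refine ⟨[c], by simp, by simp, Or.inl ?_⟩
        simpa [applySub] using h
      · obtain ⟨u, rfl⟩ := h
        rw [List.prefix_append_right_inj] at hux huy
        obtain ⟨v, hvx, hvy, hv⟩ := ih (fun e he => hx e (List.mem_cons_of_mem _ he))
          (fun e he => hy e (List.mem_cons_of_mem _ he)) hux huy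
        refine ⟨c :: v, by simpa using hvx, by simpa using hvy, ?_⟩
        simpa [applySub] using hv
    · refine ⟨[], List.nil_prefix, List.nil_prefix, ?_⟩
      rcases u with _ | ⟨k, t⟩
      · exact Or.inl List.nil_prefix
      right
      have hc := hx c (by simp)
      have hc' := hy c' (by simp)
      simp only [applySub, sig] at hux huy
      split_ifs at hux huy <;> simp [List.cons_prefix_cons] at hux huy <;>
        simp [applySub] <;> first | omega | skip
      · exact ⟨⟨hux.1, eq_singleton_of_prefix hux.2 huy.2⟩, Or.inr (by omega)⟩
      · exact ⟨⟨hux.1, eq_singleton_of_prefix huy.2 hux.2⟩, Or.inl (by omega)⟩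

/-- If `v d` is a factor of the fixed point and `v` is a prefix of it, so is `σ(v) 1`. -/
lemma applySub_append_one_prefix {d n k : ℕ} (hd : 3 ≤ d) {v : List ℕ}
    (hvd : v ++ [d] <:+: sigIter d n [1]) (hv : v <+: sigIter d k [1]) :
    ∃ m, applySub (sig d) v ++ [1] <+: sigIter d m [1] := by
  rcases List.eq_nil_or_concat v with rfl | ⟨v₀, z, rfl⟩
  · exact ⟨0, by simp [applySub, sigIter_zero]⟩
  rw [List.concat_eq_append] at *
  have hz : d = z + 1 := by
    have h := (isChain_sigIter_one hd n).infix hvd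
    have h' := h.infix (l₁ := [z, d]) ⟨v₀, [], by simp⟩
    simp [LetterStep] at h'
    omega
  set m := max k (v₀ ++ [z]).length with hm
  obtain ⟨t, ht⟩ := hv.trans (sigIter_one_prefix d (le_max_left k (v₀ ++ [z]).length))
  rw [← hm] at ht
  rcases t with _ | ⟨e, t⟩
  · have h := lt_length_sigIter_one d m
    rw [← ht, List.append_nil] at h
    omega
  have he : e = 1 ∨ e = d := by
    have h := (isChain_sigIter_one hd m).infix (l₁ := [z, e]) ⟨v₀, t, by simp [← ht]⟩
    simp [LetterStep] at h
    omega
  have hs : [1] <+: sig d e := by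
    rcases he with rfl | rfl
    · simp [sig]
    · unfold sig
      split_ifs <;> simp_all
  refine ⟨m + 1, ?_⟩
  rw [sigIter_succ, ← ht, applySub_append _ _ (e :: t), applySub, List.prefix_append_right_inj]
  exact hs.trans (List.prefix_append _ _)

lemma prefix_of_two_left_extensions {d n : ℕ} (hd : 3 ≤ d) {a b : ℕ} (hab : a ≠ b)
    {u : List ℕ} (ha : a :: u <:+: sigIter d n [1]) (hb : b :: u <:+: sigIter d n [1]) :
    ∃ m, u <+: sigIter d m [1] := by
  induction n generalizing a b u with
  | zero =>
    have h := ha.length_le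
    simp [sigIter_zero] at h
    exact ⟨0, by simp [h]⟩
  | succ n ih =>
    rcases u with _ | ⟨h, u⟩
    · exact ⟨0, List.nil_prefix⟩
    obtain rfl : h = 1 := by
      have ha' := (isChain_sigIter_one hd (n + 1)).infix ha
      have hb' := (isChain_sigIter_one hd (n + 1)).infix hb
      have ha₁ := (List.isChain_cons_cons.1 ha').1
      have hb₁ := (List.isChain_cons_cons.1 hb').1
      unfold LetterStep at ha₁ hb₁
      omega
    obtain ⟨s, t, hst⟩ := ha
    obtain ⟨s', t', hst'⟩ := hb
    rw [sigIter_succ] at hst hst'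
    obtain ⟨p, a', x, hx, hxa, hxu⟩ := exists_eq_append_of_applySub_sig (d := d) (a := a)
      (s := s) (r := u ++ t) (z := sigIter d n [1]) (by simp [← hst])
    obtain ⟨q, b', y, hy, hyb, hyu⟩ := exists_eq_append_of_applySub_sig (d := d) (a := b)
      (s := s') (r := u ++ t') (z := sigIter d n [1]) (by simp [← hst'])
    have hab' : a' ≠ b' := by
      rintro rfl
      exact hab (by simpa using hxa.symm.trans hyb)
    obtain ⟨v, hvx, hvy, hv⟩ := exists_common_prefix (d := d) (u := 1 :: u) (x := x) (y := y)
      (fun c hc => pos_of_mem_sigIter_one (d := d) (n := n) (by simp [hx, hc]))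
      (fun c hc => pos_of_mem_sigIter_one (d := d) (n := n) (by simp [hy, hc]))
      ⟨t, by simp [hxu]⟩ ⟨t', by simp [hyu]⟩
    have lift : ∀ {p' c' x' w}, sigIter d n [1] = p' ++ c' :: x' → w <+: x' →
        c' :: w <:+: sigIter d n [1] := by
      rintro p' c' _ w h ⟨r, rfl⟩
      exact ⟨p', r, by simp [h]⟩
    obtain ⟨m, hm⟩ := ih hab' (lift hx hvx) (lift hy hvy)
    rcases hv with hv | ⟨hv, hvd⟩
    · refine ⟨m + 1, hv.trans ?_⟩
      rw [sigIter_succ]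
      exact applySub_prefix _ hm
    · rw [hv]
      have hvd' : v ++ [d] <:+: sigIter d n [1] := by
        rcases hvd with h | h
        · exact (List.suffix_cons a' _).isInfix.trans (lift hx h)
        · exact (List.suffix_cons b' _).isInfix.trans (lift hy h)
      exact applySub_append_one_prefix hd hvd' hm

lemma Lang.of_infix {d : ℕ} {u v : List ℕ} (hv : Lang d v) (h : u <:+: v) : Lang d u := by
  obtain ⟨n, hn⟩ := hv
  exact ⟨n, h.trans hn⟩

lemma Lang.applySub {d : ℕ} {u : List ℕ} (hu : Lang d u) :
    Lang d (applySub (sig d) u) := by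
  obtain ⟨n, s, t, h⟩ := hu
  refine ⟨n + 1, _root_.applySub (sig d) s, _root_.applySub (sig d) t, ?_⟩
  rw [sigIter_succ, ← h, applySub_append, applySub_append]

lemma lang_pair {d k : ℕ} (hk : 1 ≤ k) (hkd : k < d) : Lang d [k, k + 1] := by
  induction k, hk using Nat.le_induction with
  | base => exact ⟨1, List.infix_rfl⟩
  | succ k hk ih =>
    refine (ih (by omega)).applySub.of_infix ?_
    have h₁ : k + 1 ≠ d := by omega
    have h₂ : k ≠ d := by omega
    by_cases h : k = 1
    · subst h
      exact ⟨[1], [], by simp [applySub, sig, h₁]⟩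
    · exact ⟨[], [], by simp [applySub, sig, h, h₁, h₂]; omega⟩

lemma leftSpecial_one {d : ℕ} (hd : 3 ≤ d) : LeftSpecial d [1] := by
  obtain ⟨k, rfl⟩ : ∃ k, d = k + 1 := ⟨d - 1, by omega⟩
  have hk : k ≠ 1 := by omega
  have hk₀ : k ≠ 0 := by omega
  have hd1 : Lang (k + 1) [k + 1, 1] := by
    refine (lang_pair (d := k + 1) (k := k) (by omega) (by omega)).applySub.of_infix
      ⟨[], [], ?_⟩
    simp [applySub, sig, hk, hk₀]
  have h11 : Lang (k + 1) [1, 1] := by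
    refine hd1.applySub.of_infix ⟨[], [2], ?_⟩
    simp [applySub, sig, hk₀]
  exact ⟨k + 1, 1, by omega, by omega, le_rfl, le_rfl, by omega, hd1, h11⟩

lemma Lang.exists_cons_applySub {d a : ℕ} {u : List ℕ} (h : Lang d (a :: u)) :
    Lang d ((if a = 1 then 2 else if a = d then 1 else a + 1) ::
      _root_.applySub (sig d) u) := by
  refine h.applySub.of_infix (List.IsSuffix.isInfix ?_)
  simp only [_root_.applySub, sig]
  split_ifs <;> simp

lemma LeftSpecial.applySub {d : ℕ} {u : List ℕ} (hd : 3 ≤ d) (h : LeftSpecial d u) :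
    LeftSpecial d (applySub (sig d) u) := by
  obtain ⟨a, b, hab, ha₁, had, hb₁, hbd, ha, hb⟩ := h
  refine ⟨_, _, ?_, ?_, ?_, ?_, ?_, ha.exists_cons_applySub, hb.exists_cons_applySub⟩ <;>
    split_ifs <;> omega

lemma leftSpecial_sigIter_one {d : ℕ} (hd : 3 ≤ d) (n : ℕ) :
    LeftSpecial d (sigIter d n [1]) := by
  induction n with
  | zero => exact leftSpecial_one hd
  | succ n ih =>
    rw [sigIter_succ]
    exact ih.applySub hd

lemma LeftSpecial.of_prefix {d : ℕ} {u v : List ℕ} (hv : LeftSpecial d v) (h : u <+: v) :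
    LeftSpecial d u := by
  obtain ⟨a, b, hab, ha₁, had, hb₁, hbd, ha, hb⟩ := hv
  have key (c : ℕ) : c :: u <:+: c :: v := (List.cons_prefix_cons.2 ⟨rfl, h⟩).isInfix
  exact ⟨a, b, hab, ha₁, had, hb₁, hbd, ha.of_infix (key a), hb.of_infix (key b)⟩

/-- A word u ∈ L(Ω) is left-special iff u is a (possibly empty) prefix of the fixed
point ω. -/
theorem stmt_6 (d : ℕ) (hd : 3 ≤ d) (ω : ℕ → ℕ) (hω : IsSigmaFixedPoint d ω)
    (u : List ℕ) (hu : Lang d u) :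
    LeftSpecial d u ↔ PrefixOfInf u ω := by
  rw [prefixOfInf_iff hω]
  constructor
  · rintro ⟨a, b, hab, -, -, -, -, ⟨m, hm⟩, ⟨n, hn⟩⟩
    exact prefix_of_two_left_extensions hd hab
      (hm.trans (sigIter_one_prefix d (le_max_left m n)).isInfix)
      (hn.trans (sigIter_one_prefix d (le_max_right m n)).isInfix)
  · rintro ⟨n, hn⟩
    exact (leftSpecial_sigIter_one hd n).of_prefix hn
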